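/- arXiv:1901.07671 — 2 statements merged into one kernel-verified Lean document; each statement's English description precedes it below -/
import Mathlib

section
/- Let n ≥ 1 and let u be a non-constant solution of the Allen–Cahn equation −Δu = u − u³ on ℝⁿ. Then the zero level set {x ∈ ℝⁿ : u(x) = 0} is nonempty, and |u(x)| → 1 as dist(x, {u = 0}) → +∞; that is, for every ε > 0 there exists R > 0 such that every x ∈ ℝⁿ with dist(x, {u = 0}) ≥ R satisfies 1 − |u(x)| ≤ ε. -/
open scoped RealInnerProductSpace

noncomputable def laplacian {n : ℕ} (u : EuclideanSpace ℝ (Fin n) → ℝ)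
    (x : EuclideanSpace ℝ (Fin n)) : ℝ :=
  ∑ i : Fin n, fderiv ℝ (fun y => fderiv ℝ u y (EuclideanSpace.single i 1)) x
    (EuclideanSpace.single i 1)

def IsACSolution {n : ℕ} (u : EuclideanSpace ℝ (Fin n) → ℝ) : Prop :=
  ContDiff ℝ 2 u ∧ ∀ x, -laplacian u x = u x - (u x) ^ 3

noncomputable def H (t : ℝ) : ℝ := Real.tanh (t / Real.sqrt 2)

open Filter Topology

theorem second_test (g g' : ℝ → ℝ) (c : ℝ) (hg : ∀ᶠ t in 𝓝 (0:ℝ), HasDerivAt g (g' t) t)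
    (hc : HasDerivAt g' c 0) (hm : IsLocalMin g 0) : 0 ≤ c := by
  by_contra hneg
  push Not at hneg
  have e1 : deriv g =ᶠ[𝓝 0] g' := hg.mono fun t ht => ht.deriv
  have hdd : deriv (deriv g) 0 = c := by rw [e1.deriv_eq, hc.deriv]
  have hM : IsLocalMax g 0 :=
    isLocalMax_of_deriv_deriv_neg (by rw [hdd]; exact hneg) hm.deriv_eq_zero
      hg.self_of_nhds.continuousAt
  have hconst : g =ᶠ[𝓝 0] fun _ => g 0 := by
    filter_upwards [hm, hM] with t h1 h2
    exact le_antisymm h2 h1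
  have h0 : deriv (deriv g) 0 = 0 := by
    rw [hconst.deriv.deriv_eq]
    simp
  linarith

theorem line_deriv {n : ℕ} (u : EuclideanSpace ℝ (Fin n) → ℝ) (hu : ContDiff ℝ 2 u)
    (x e : EuclideanSpace ℝ (Fin n)) :
    (∀ t : ℝ, HasDerivAt (fun t : ℝ => u (x + t • e)) (fderiv ℝ u (x + t • e) e) t) ∧
    HasDerivAt (fun t : ℝ => fderiv ℝ u (x + t • e) e)
      (fderiv ℝ (fun y => fderiv ℝ u y e) x e) 0 := by
  have hl : ∀ t : ℝ, HasDerivAt (fun t : ℝ => x + t • e) e t := fun t => by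
    simpa using ((hasDerivAt_id t).smul_const e).const_add x
  constructor
  · intro t
    have := (hu.differentiable (by norm_num) (x + t • e)).hasFDerivAt
    exact this.comp_hasDerivAt t (hl t)
  · have h1 : ContDiff ℝ 1 (fderiv ℝ u) := hu.fderiv_right (by norm_num)
    have h2 : Differentiable ℝ (fun y => fderiv ℝ u y e) :=
      (h1.differentiable (by norm_num)).clm_apply (differentiable_const e)
    have h3 := (h2 (x + (0:ℝ) • e)).hasFDerivAt
    have h4 := h3.comp_hasDerivAt (0:ℝ) (hl 0)
    refine h4.congr_deriv ?_
    simp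

theorem touch {n : ℕ} (u : EuclideanSpace ℝ (Fin n) → ℝ) (hu : ContDiff ℝ 2 u)
    (x : EuclideanSpace ℝ (Fin n)) (p p' : Fin n → ℝ → ℝ) (c : Fin n → ℝ)
    (hp : ∀ i, ∀ᶠ t in 𝓝 (0:ℝ), HasDerivAt (p i) (p' i t) t)
    (hc : ∀ i, HasDerivAt (p' i) (c i) 0)
    (h0 : ∀ i, p i 0 = u x)
    (hle : ∀ i, ∀ᶠ t in 𝓝 (0:ℝ), p i t ≤ u (x + t • EuclideanSpace.single i 1)) :
    ∑ i, c i ≤ laplacian u x := by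
  unfold laplacian
  refine Finset.sum_le_sum fun i _ => ?_
  obtain ⟨h1, h2⟩ := line_deriv u hu x (EuclideanSpace.single i 1)
  have := second_test (fun t => u (x + t • EuclideanSpace.single i 1) - p i t) _ _
    ((hp i).mono fun t ht => (h1 t).sub ht) (h2.sub (hc i)) (by
      filter_upwards [hle i] with t ht
      simp only [zero_smul, add_zero, h0 i]
      linarith)
  linarith

theorem laplacian_neg' {n : ℕ} (u : EuclideanSpace ℝ (Fin n) → ℝ)
    (x : EuclideanSpace ℝ (Fin n)) : laplacian (fun y => - u y) x = - laplacian u x := by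
  unfold laplacian
  rw [← Finset.sum_neg_distrib]
  refine Finset.sum_congr rfl fun i _ => ?_
  simp [fderiv_fun_neg]

theorem sol_neg {n : ℕ} {u : EuclideanSpace ℝ (Fin n) → ℝ} (hu : IsACSolution u) :
    IsACSolution (fun y => - u y) := by
  refine ⟨hu.1.neg, fun x => ?_⟩
  rw [laplacian_neg']
  have := hu.2 x
  linear_combination -this

/-- The radial profile `1 - |x - x0|^2 / R^2`. -/
noncomputable def prof {n : ℕ} (x0 : EuclideanSpace ℝ (Fin n)) (R : ℝ)
    (x : EuclideanSpace ℝ (Fin n)) : ℝ := 1 - ‖x - x0‖ ^ 2 / R ^ 2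

theorem prof_line {n : ℕ} (x0 : EuclideanSpace ℝ (Fin n)) (R : ℝ)
    (x : EuclideanSpace ℝ (Fin n)) (i : Fin n) (t : ℝ) :
    prof x0 R (x + t • EuclideanSpace.single i 1) =
      prof x0 R x - (2 * t * (x - x0) i + t ^ 2) / R ^ 2 := by
  unfold prof
  have : x + t • EuclideanSpace.single i (1:ℝ) - x0
      = (x - x0) + t • EuclideanSpace.single i (1:ℝ) := by abel
  rw [this, norm_add_sq_real, inner_smul_right, norm_smul]
  simp [EuclideanSpace.inner_single_right, mul_pow]
  ring

theorem prof_line_deriv {n : ℕ} (x0 : EuclideanSpace ℝ (Fin n)) (R : ℝ)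
    (x : EuclideanSpace ℝ (Fin n)) (i : Fin n) (t : ℝ) :
    HasDerivAt (fun t : ℝ => prof x0 R (x + t • EuclideanSpace.single i 1))
      (-(2 * (x - x0) i + 2 * t) / R ^ 2) t := by
  simp_rw [prof_line]
  have h1 : HasDerivAt (fun t : ℝ => 2 * t * (x - x0) i + t ^ 2) (2 * (x - x0) i + 2 * t) t := by
    have := (((hasDerivAt_id t).const_mul 2).mul_const ((x - x0) i)).add (hasDerivAt_pow 2 t)
    refine this.congr_deriv ?_
    simp
  have h2 := (h1.div_const (R ^ 2)).const_sub (prof x0 R x)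
  refine h2.congr_deriv ?_
  ring

theorem prof_line_deriv2 {n : ℕ} (x0 : EuclideanSpace ℝ (Fin n)) (R : ℝ)
    (x : EuclideanSpace ℝ (Fin n)) (i : Fin n) (t : ℝ) :
    HasDerivAt (fun t : ℝ => -(2 * (x - x0) i + 2 * t) / R ^ 2) (-2 / R ^ 2) t := by
  have h1 : HasDerivAt (fun t : ℝ => -(2 * (x - x0) i + 2 * t)) (-2) t := by
    have := (((hasDerivAt_id t).const_mul 2).const_add (2 * (x - x0) i)).neg
    refine this.congr_deriv ?_
    simp
  exact h1.div_const _

theorem prof_cont {n : ℕ} (x0 : EuclideanSpace ℝ (Fin n)) (R : ℝ) :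
    Continuous (prof x0 R) := by
  unfold prof
  fun_prop

theorem prof_nonneg {n : ℕ} {x0 : EuclideanSpace ℝ (Fin n)} {R : ℝ} (hR : 0 < R)
    {x : EuclideanSpace ℝ (Fin n)} : 0 ≤ prof x0 R x ↔ x ∈ Metric.closedBall x0 R := by
  unfold prof
  rw [sub_nonneg, div_le_one (by positivity), Metric.mem_closedBall, dist_eq_norm,
    pow_le_pow_iff_left₀ (norm_nonneg _) hR.le (by norm_num)]

theorem sum_sq {n : ℕ} (y : EuclideanSpace ℝ (Fin n)) : ∑ i, (y i) ^ 2 = ‖y‖ ^ 2 := by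
  rw [EuclideanSpace.norm_sq_eq]
  simp

theorem prof_norm {n : ℕ} (x0 : EuclideanSpace ℝ (Fin n)) {R : ℝ} (hR : 0 < R)
    (x : EuclideanSpace ℝ (Fin n)) : ‖x - x0‖ ^ 2 = (1 - prof x0 R x) * R ^ 2 := by
  unfold prof
  field_simp
  ring

theorem ev_line {n : ℕ} {P : EuclideanSpace ℝ (Fin n) → Prop} {x : EuclideanSpace ℝ (Fin n)}
    (h : ∀ᶠ y in 𝓝 x, P y) (e : EuclideanSpace ℝ (Fin n)) :
    ∀ᶠ t in 𝓝 (0:ℝ), P (x + t • e) := by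
  have hc : Continuous (fun t : ℝ => x + t • e) := by fun_prop
  have : Tendsto (fun t : ℝ => x + t • e) (𝓝 0) (𝓝 x) := by
    simpa using hc.tendsto 0
  exact this.eventually h

theorem lower {n : ℕ} {u : EuclideanSpace ℝ (Fin n) → ℝ} (hu : IsACSolution u)
    {A R : ℝ} (hA : 0 < A) (hA1 : A < 1) (hR : 0 < R)
    (hRA : 4 * n * (8 + 4 * n) ^ 2 ≤ 64 * (1 - A ^ 2) * R ^ 2)
    (x0 : EuclideanSpace ℝ (Fin n)) (hpos : ∀ x ∈ Metric.closedBall x0 R, 0 < u x) :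
    A ≤ u x0 := by
  have hx0 : x0 ∈ Metric.closedBall x0 R := Metric.mem_closedBall_self hR.le
  have hK : IsCompact (Metric.closedBall x0 R) := isCompact_closedBall x0 R
  have huc : Continuous u := hu.1.continuous
  have hcont : ContinuousOn (fun x => A * prof x0 R x ^ 2 / u x) (Metric.closedBall x0 R) :=
    ContinuousOn.div (((prof_cont x0 R).pow 2).const_mul A |>.continuousOn) huc.continuousOn
      fun x hx => (hpos x hx).ne'
  obtain ⟨x1, hx1, hmax⟩ := hK.exists_isMaxOn ⟨x0, hx0⟩ hcont
  by_contra hlt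
  push Not at hlt
  have hu1 := hpos x1 hx1
  set s := prof x0 R x1 with hs
  have hs0 : 0 ≤ s := (prof_nonneg hR).2 hx1
  have hbig : 1 < A * s ^ 2 / u x1 := by
    have h1 : A * prof x0 R x0 ^ 2 / u x0 ≤ A * s ^ 2 / u x1 := hmax hx0
    have h2 : prof x0 R x0 = 1 := by simp [prof]
    rw [h2] at h1
    have : 1 < A * 1 ^ 2 / u x0 := by
      rw [lt_div_iff₀ (hpos x0 hx0)]; linarith
    linarith
  have hs1 : 0 < s := by
    rcases hs0.eq_or_lt with h | h
    · rw [← h] at hbig; norm_num at hbig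
    · exact h
  rw [lt_div_iff₀ hu1, one_mul] at hbig
  set m := u x1 / (A * s ^ 2) with hm
  have hm0 : 0 < m := by positivity
  have hm1 : m < 1 := by rw [hm, div_lt_one (by positivity)]; exact hbig
  have humx : u x1 = m * A * s ^ 2 := by rw [hm]; field_simp
  have hev : ∀ᶠ y in 𝓝 x1, m * A * prof x0 R y ^ 2 ≤ u y := by
    have : ∀ᶠ y in 𝓝 x1, 0 < prof x0 R y := (prof_cont x0 R).continuousAt.eventually (lt_mem_nhds hs1)
    filter_upwards [this] with y hy
    have hyb := (prof_nonneg hR).1 hy.le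
    have h1 : A * prof x0 R y ^ 2 / u y ≤ A * s ^ 2 / u x1 := hmax hyb
    have huy := hpos y hyb
    rw [div_le_div_iff₀ huy hu1] at h1
    have : m * A * prof x0 R y ^ 2 = (A * prof x0 R y ^ 2 * u x1) / (A * s ^ 2) := by
      rw [hm]; ring
    rw [this, div_le_iff₀ (by positivity)]
    linarith
  have key := touch u hu.1 x1
    (fun i t => m * A * prof x0 R (x1 + t • EuclideanSpace.single i 1) ^ 2)
    (fun i t => m * A * (2 * prof x0 R (x1 + t • EuclideanSpace.single i 1) *
      (-(2 * (x1 - x0) i + 2 * t) / R ^ 2)))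
    (fun i => m * A * 2 * (4 * ((x1 - x0) i) ^ 2 / R ^ 4 - 2 * s / R ^ 2))
    (fun i => Eventually.of_forall fun t => by
      have := ((prof_line_deriv x0 R x1 i t).pow 2).const_mul (m * A)
      refine this.congr_deriv ?_
      simp)
    (fun i => by
      have := (((prof_line_deriv x0 R x1 i 0).const_mul 2).mul
        (prof_line_deriv2 x0 R x1 i 0)).const_mul (m * A)
      refine this.congr_deriv ?_
      simp only [zero_smul, add_zero, ← hs]
      field_simp
      ring)
    (fun i => by simp only [zero_smul, add_zero, ← hs]; exact humx.symm)
    (fun i => ev_line hev _)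
  have hpde := hu.2 x1
  rw [← Finset.mul_sum, Finset.sum_sub_distrib, ← Finset.sum_div, ← Finset.mul_sum,
    sum_sq, prof_norm x0 hR] at key
  simp only [Finset.sum_const, Finset.card_univ, Fintype.card_fin, nsmul_eq_mul, ← hs] at key
  have hlap : laplacian u x1 = (m * A * s ^ 2) ^ 3 - m * A * s ^ 2 := by
    rw [← humx]; linarith
  rw [hlap] at key
  have hsle : s ≤ 1 := by
    rw [hs]; unfold prof
    have : 0 ≤ ‖x1 - x0‖ ^ 2 / R ^ 2 := by positivity
    linarith
  have hmA : 0 < m * A := by positivity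
  have e : m * A * 2 * (4 * ((1 - s) * R ^ 2) / R ^ 4 - n * (2 * s / R ^ 2))
      = m * A * ((8 * (1 - s) - 4 * n * s) / R ^ 2) := by
    field_simp
    ring
  rw [e] at key
  have key2 : (8 * (1 - s) - 4 * n * s) / R ^ 2 ≤ (m * A) ^ 2 * s ^ 6 - s ^ 2 := by
    have : (m * A * s ^ 2) ^ 3 - m * A * s ^ 2 = m * A * ((m * A) ^ 2 * s ^ 6 - s ^ 2) := by ring
    rw [this] at key
    exact le_of_mul_le_mul_left key hmA
  have hmA2 : (m * A) ^ 2 < A ^ 2 := by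
    have : m * A < A := by nlinarith
    exact pow_lt_pow_left₀ this hmA.le (by norm_num)
  have hs6 : (m * A) ^ 2 * s ^ 6 < A ^ 2 * s ^ 2 := by
    have h6 : s ^ 6 ≤ s ^ 2 := pow_le_pow_of_le_one hs0 hsle (by norm_num)
    have : 0 < s ^ 2 := by positivity
    nlinarith [sq_nonneg (m * A)]
  have key3 : (8 * (1 - s) - 4 * n * s) / R ^ 2 < -((1 - A ^ 2) * s ^ 2) := by linarith
  rw [div_lt_iff₀ (by positivity)] at key3
  have hA2 : A ^ 2 < 1 := by nlinarith
  have hn0 : (0:ℝ) ≤ n := Nat.cast_nonneg n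
  have hq : 0 ≤ (1 - A ^ 2) * R ^ 2 := by
    have : 0 ≤ 1 - A ^ 2 := by linarith
    positivity
  have hs8 : 8 < (8 + 4 * n) * s := by
    have : 0 ≤ (1 - A ^ 2) * s ^ 2 * R ^ 2 := by
      have : 0 ≤ 1 - A ^ 2 := by linarith
      positivity
    nlinarith
  have h64 : 64 ≤ ((8 + 4 * n) * s) ^ 2 := by nlinarith
  have f1 : 64 * ((1 - A ^ 2) * R ^ 2) ≤ ((8 + 4 * n) * s) ^ 2 * ((1 - A ^ 2) * R ^ 2) :=
    mul_le_mul_of_nonneg_right h64 hq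
  have f2 : (8 + 4 * (n:ℝ)) ^ 2 * (4 * n) ≤ (8 + 4 * (n:ℝ)) ^ 2 * ((1 - A ^ 2) * R ^ 2 * s ^ 2) := by
    linarith
  have f3 := le_of_mul_le_mul_left f2 (by positivity)
  have f4 : 4 * (n:ℝ) * s ≤ 4 * n := by nlinarith
  linarith

theorem upper {n : ℕ} {u : EuclideanSpace ℝ (Fin n) → ℝ} (hu : IsACSolution u)
    {A R : ℝ} (hA : 0 < A) (hR : 0 < R) (hRA : 2 * n + 8 ≤ A ^ 2 * R ^ 2)
    (x0 : EuclideanSpace ℝ (Fin n)) : u x0 ≤ 1 + A := by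
  have hx0 : x0 ∈ Metric.closedBall x0 R := Metric.mem_closedBall_self hR.le
  have hK : IsCompact (Metric.closedBall x0 R) := isCompact_closedBall x0 R
  have huc : Continuous u := hu.1.continuous
  have hcont : ContinuousOn (fun x => (u x - 1) * prof x0 R x) (Metric.closedBall x0 R) :=
    ((huc.sub continuous_const).mul (prof_cont x0 R)).continuousOn
  obtain ⟨x1, hx1, hmax⟩ := hK.exists_isMaxOn ⟨x0, hx0⟩ hcont
  by_contra hlt
  push Not at hlt
  set s := prof x0 R x1 with hs
  have hs0 : 0 ≤ s := (prof_nonneg hR).2 hx1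
  set M := (u x1 - 1) * s with hM
  have hMA : A < M := by
    have h1 : (u x0 - 1) * prof x0 R x0 ≤ M := hmax hx0
    have h2 : prof x0 R x0 = 1 := by simp [prof]
    rw [h2] at h1
    linarith
  have hs1 : 0 < s := by
    rcases hs0.eq_or_lt with h | h
    · rw [← h, mul_zero] at hM; linarith
    · exact h
  have hux : u x1 = 1 + M / s := by rw [hM]; field_simp; ring
  have hevp : ∀ᶠ y in 𝓝 x1, 0 < prof x0 R y := (prof_cont x0 R).continuousAt.eventually (lt_mem_nhds hs1)
  have hev : ∀ᶠ y in 𝓝 x1, -1 - M / prof x0 R y ≤ - u y := by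
    filter_upwards [hevp] with y hy
    have hyb := (prof_nonneg hR).1 hy.le
    have h1 : (u y - 1) * prof x0 R y ≤ M := hmax hyb
    rw [← le_div_iff₀ hy] at h1
    linarith
  have key := touch (fun y => - u y) hu.1.neg x1
    (fun i t => -1 - M / prof x0 R (x1 + t • EuclideanSpace.single i 1))
    (fun i t => M * (-(2 * (x1 - x0) i + 2 * t) / R ^ 2) /
      prof x0 R (x1 + t • EuclideanSpace.single i 1) ^ 2)
    (fun i => -(8 * M / (R ^ 4 * s ^ 3) * ((x1 - x0) i) ^ 2 + 2 * M / (R ^ 2 * s ^ 2)))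
    (fun i => by
      filter_upwards [ev_line hevp (EuclideanSpace.single i 1)] with t ht
      have := (((hasDerivAt_const t M).div (prof_line_deriv x0 R x1 i t) ht.ne').const_sub (-1))
      refine this.congr_deriv ?_
      ring)
    (fun i => by
      have := ((prof_line_deriv2 x0 R x1 i 0).const_mul M).div
        ((prof_line_deriv x0 R x1 i 0).pow 2) (by simp [← hs, hs1.ne'])
      refine this.congr_deriv ?_
      simp only [Pi.pow_apply, zero_smul, add_zero, ← hs]
      field_simp
      ring)
    (fun i => by simp only [zero_smul, add_zero, ← hs]; linarith)
    (fun i => ev_line hev _)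
  have hpde := hu.2 x1
  rw [laplacian_neg', hpde, Finset.sum_neg_distrib, Finset.sum_add_distrib, ← Finset.mul_sum,
    sum_sq, prof_norm x0 hR] at key
  simp only [Finset.sum_const, Finset.card_univ, Fintype.card_fin, nsmul_eq_mul, ← hs] at key
  have hsle : s ≤ 1 := by
    rw [hs]; unfold prof
    have : 0 ≤ ‖x1 - x0‖ ^ 2 / R ^ 2 := by positivity
    linarith
  have hM0 : 0 < M := hA.trans hMA
  have hw : 0 < M / s := by positivity
  have hcube : (M / s) ^ 3 ≤ u x1 ^ 3 - u x1 := by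
    rw [hux]; nlinarith [pow_pos hw 2]
  have e : 8 * M / (R ^ 4 * s ^ 3) * ((1 - s) * R ^ 2) + n * (2 * M / (R ^ 2 * s ^ 2))
      = M * (8 * (1 - s) + 2 * n * s) / (R ^ 2 * s ^ 3) := by
    field_simp
  have k2 : (M / s) ^ 3 ≤ M * (8 * (1 - s) + 2 * n * s) / (R ^ 2 * s ^ 3) := by
    rw [← e]; linarith
  have e2 : (M / s) ^ 3 = M * (M ^ 2 * R ^ 2) / (R ^ 2 * s ^ 3) := by
    field_simp
  rw [e2, div_le_div_iff_of_pos_right (by positivity)] at k2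
  have k3 := le_of_mul_le_mul_left k2 hM0
  have hn0 : (0:ℝ) ≤ n := Nat.cast_nonneg n
  have k4 : A ^ 2 * R ^ 2 < M ^ 2 * R ^ 2 := by
    have : A ^ 2 < M ^ 2 := pow_lt_pow_left₀ hMA hA.le (by norm_num)
    have : 0 < R ^ 2 := by positivity
    nlinarith
  nlinarith

theorem upper_one {n : ℕ} {u : EuclideanSpace ℝ (Fin n) → ℝ} (hu : IsACSolution u)
    (x0 : EuclideanSpace ℝ (Fin n)) : u x0 ≤ 1 := by
  refine le_of_forall_pos_le_add fun A hA => ?_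
  have hn0 : (0:ℝ) ≤ n := Nat.cast_nonneg n
  refine upper (R := (2 * n + 8) / A) hu hA (by positivity) ?_ x0
  have : A ^ 2 * ((2 * n + 8) / A) ^ 2 = (2 * (n:ℝ) + 8) ^ 2 := by field_simp
  rw [this]; nlinarith

theorem exists_R (n : ℕ) {A : ℝ} (hA : 0 < A) (hA1 : A < 1) :
    ∃ R : ℝ, 0 < R ∧ 4 * n * (8 + 4 * n) ^ 2 ≤ 64 * (1 - A ^ 2) * R ^ 2 := by
  have hA2 : 0 < 1 - A ^ 2 := by nlinarith
  have hn0 : (0:ℝ) ≤ n := Nat.cast_nonneg n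
  set C := 4 * (n:ℝ) * (8 + 4 * n) ^ 2 / (64 * (1 - A ^ 2)) with hC
  have hC0 : 0 ≤ C := by positivity
  refine ⟨C + 1, by positivity, ?_⟩
  have : C ≤ (C + 1) ^ 2 := by nlinarith
  rw [hC, div_le_iff₀ (by positivity)] at this
  linarith

theorem sign_const {n : ℕ} {u : EuclideanSpace ℝ (Fin n) → ℝ} (huc : Continuous u)
    {S : Set (EuclideanSpace ℝ (Fin n))} (hS : IsPreconnected S) (h0 : ∀ x ∈ S, u x ≠ 0) :
    (∀ x ∈ S, 0 < u x) ∨ (∀ x ∈ S, 0 < - u x) := by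
  by_contra h
  push Not at h
  obtain ⟨⟨a, ha, hua⟩, b, hb, hub⟩ := h
  obtain ⟨c, hc, hc0⟩ := hS.intermediate_value ha hb huc.continuousOn
    (show (0:ℝ) ∈ Set.Icc (u a) (u b) from ⟨hua, by linarith⟩)
  exact h0 c hc hc0

theorem no_pos {n : ℕ} {u : EuclideanSpace ℝ (Fin n) → ℝ} (hu : IsACSolution u)
    (hpos : ∀ x, 0 < u x) (x : EuclideanSpace ℝ (Fin n)) : u x = 1 := by
  refine le_antisymm (upper_one hu x) ?_
  by_contra h
  push Not at h
  have h0 := hpos x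
  obtain ⟨R, hR, hRA⟩ := exists_R n (A := (1 + u x) / 2) (by linarith) (by linarith)
  have := lower hu (by linarith) (by linarith) hR hRA x fun y _ => hpos y
  linarith

theorem level_set_nonempty_and_limit {n : ℕ} (hn1 : 1 ≤ n)
    (u : EuclideanSpace ℝ (Fin n) → ℝ)
    (hu : IsACSolution u) (hnc : ¬ ∃ c : ℝ, ∀ x, u x = c) :
    {x : EuclideanSpace ℝ (Fin n) | u x = 0}.Nonempty ∧
    ∀ ε : ℝ, 0 < ε → ∃ R : ℝ, 0 < R ∧
      ∀ x : EuclideanSpace ℝ (Fin n),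
        R ≤ Metric.infDist x {y : EuclideanSpace ℝ (Fin n) | u y = 0} →
        1 - |u x| ≤ ε := by
  have huc : Continuous u := hu.1.continuous
  constructor
  · by_contra hne
    rw [Set.not_nonempty_iff_eq_empty] at hne
    have h0 : ∀ x ∈ (Set.univ : Set (EuclideanSpace ℝ (Fin n))), u x ≠ 0 := fun x _ hx => by
      have : x ∈ {x : EuclideanSpace ℝ (Fin n) | u x = 0} := hx
      rw [hne] at this
      exact this
    rcases sign_const huc isPreconnected_univ h0 with h | h
    · exact hnc ⟨1, no_pos hu fun x => h x trivial⟩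
    · refine hnc ⟨-1, fun x => ?_⟩
      have := no_pos (sol_neg hu) (fun x => h x trivial) x
      linarith
  · intro ε hε
    by_cases hε1 : 1 ≤ ε
    · exact ⟨1, one_pos, fun x _ => by linarith [abs_nonneg (u x)]⟩
    push Not at hε1
    obtain ⟨R, hR, hRA⟩ := exists_R n (A := 1 - ε) (by linarith) (by linarith)
    refine ⟨R + 1, by linarith, fun x hx => ?_⟩
    have h0 : ∀ y ∈ Metric.closedBall x R, u y ≠ 0 := fun y hy hy0 => by
      have h1 := Metric.infDist_le_dist_of_mem (x := x)
        (show y ∈ {y : EuclideanSpace ℝ (Fin n) | u y = 0} from hy0)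
      rw [Metric.mem_closedBall, dist_comm] at hy
      linarith
    rcases sign_const huc (convex_closedBall x R).isPreconnected h0 with h | h
    · have := lower hu (by linarith) (by linarith) hR hRA x h
      linarith [le_abs_self (u x)]
    · have := lower (sol_neg hu) (by linarith) (by linarith) hR hRA x h
      linarith [neg_le_abs (u x)]
end

section
/- Let n ≥ 1 and let u be a solution of the Allen–Cahn equation −Δu = u − u³ on ℝⁿ with −1 < u(x) < 1 for all x, such that u(x) → −1 as xₙ → −∞ uniformly in the other variables (for every ε > 0 there exists R > 0 with |u(x) + 1| ≤ ε whenever xₙ ≤ −R). Let A > 0 be such that u(x) ≤ −1/√3 whenever xₙ ≤ −A and tanh(A/√2) ≥ 1/√3. Then for every ω ≥ 2A and every x ∈ ℝⁿ, u(x) ≤ H(xₙ + ω). -/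
open scoped RealInnerProductSpace

theorem H_hasDerivAt (t : ℝ) : HasDerivAt H ((1 - H t ^ 2) / Real.sqrt 2) t := by
  have hc : Real.cosh (t / Real.sqrt 2) ≠ 0 := (Real.cosh_pos _).ne'
  have h1 : HasDerivAt (fun s : ℝ => s / Real.sqrt 2) (1 / Real.sqrt 2) t :=
    (hasDerivAt_id t).div_const _
  have h2 := (h1.sinh).div (h1.cosh) hc
  have h3 : H = (fun s : ℝ => Real.sinh (s / Real.sqrt 2)) / fun s : ℝ => Real.cosh (s / Real.sqrt 2) := by
    funext s
    simp [H, Real.tanh_eq_sinh_div_cosh]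
  have h4 : H t = Real.sinh (t / Real.sqrt 2) / Real.cosh (t / Real.sqrt 2) := by
    simp [H, Real.tanh_eq_sinh_div_cosh]
  rw [h4, h3]
  refine h2.congr_deriv ?_
  have : Real.sqrt 2 ≠ 0 := by positivity
  field_simp

theorem H_deriv2 (t : ℝ) :
    HasDerivAt (fun s => (1 - H s ^ 2) / Real.sqrt 2) (H t ^ 3 - H t) t := by
  have h := (((H_hasDerivAt t).pow 2).const_sub 1).div_const (Real.sqrt 2)
  refine h.congr_deriv ?_
  have h2 : Real.sqrt 2 ≠ 0 := by positivity
  have h3 : Real.sqrt 2 ^ 2 = 2 := Real.sq_sqrt (by norm_num)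
  field_simp
  rw [h3]
  push_cast
  ring

theorem H_sq_lt (t : ℝ) : H t ^ 2 < 1 := Real.tanh_sq_lt_one _

theorem H_mono : Monotone H := by
  apply monotone_of_deriv_nonneg (fun t => (H_hasDerivAt t).differentiableAt)
  intro t
  rw [(H_hasDerivAt t).deriv]
  have := H_sq_lt t
  apply div_nonneg <;> [linarith; positivity]

theorem second_deriv_nonpos (g g' : ℝ → ℝ) (c : ℝ) (hg : ∀ t, HasDerivAt g (g' t) t)
    (hg' : HasDerivAt g' c 0) (hmax : IsLocalMax g 0) : c ≤ 0 := by
  by_contra! hc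
  have hd : deriv g = g' := funext fun t => (hg t).deriv
  have hmin : IsLocalMin g 0 :=
    isLocalMin_of_deriv_deriv_pos (by rw [hd, hg'.deriv]; exact hc) hmax.deriv_eq_zero
      (hg 0).continuousAt
  have hconst : g =ᶠ[nhds 0] fun _ => g 0 := by
    filter_upwards [hmax, hmin] with t h1 h2 using le_antisymm h1 h2
  have h1 := hconst.deriv.deriv_eq
  rw [hd, hg'.deriv] at h1
  simp at h1
  exact hc.ne' h1

theorem cubic_pos (a b : ℝ) (ha : 1 / Real.sqrt 3 ≤ a) (hab : a ≤ b) :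
    (b - a) ^ 3 ≤ (b ^ 3 - b) - (a ^ 3 - a) := by
  have h3 : (1 / Real.sqrt 3) ^ 2 = 1 / 3 := by
    rw [div_pow, Real.sq_sqrt (by norm_num)]; norm_num
  have h0 : 0 < 1 / Real.sqrt 3 := by positivity
  have ha2 : 1 / 3 ≤ a ^ 2 := by rw [← h3]; gcongr
  have ha0 : 0 ≤ a := h0.le.trans ha
  have hd : 0 ≤ b - a := sub_nonneg.2 hab
  have e : (b ^ 3 - b) - (a ^ 3 - a) - (b - a) ^ 3
      = (b - a) * (3 * (a ^ 2 - 1 / 3)) + 3 * (a * (b - a) ^ 2) := by ring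
  have p1 : 0 ≤ (b - a) * (3 * (a ^ 2 - 1 / 3)) := mul_nonneg hd (by linarith)
  have p2 : 0 ≤ a * (b - a) ^ 2 := by positivity
  linarith

theorem dir_ineq {n : ℕ} (u : EuclideanSpace ℝ (Fin n) → ℝ) (hu : ContDiff ℝ 2 u)
    (k : Fin n) (ω ε : ℝ) (x₀ x : EuclideanSpace ℝ (Fin n))
    (hmax : ∀ y, u y - H (y k + ω) - ε * ‖y - x₀‖ ^ 2 ≤ u x - H (x k + ω) - ε * ‖x - x₀‖ ^ 2)
    (i : Fin n) :
    fderiv ℝ (fun y => fderiv ℝ u y (EuclideanSpace.single i 1)) x (EuclideanSpace.single i 1)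
      ≤ (if k = i then H (x k + ω) ^ 3 - H (x k + ω) else 0) + 2 * ε := by
  set e : EuclideanSpace ℝ (Fin n) := EuclideanSpace.single i 1 with he
  set c : ℝ := if k = i then 1 else 0 with hc
  have hec : e k = c := by simp [he, hc]
  have hline : ∀ t : ℝ, HasDerivAt (fun s : ℝ => x + s • e) e t := by
    intro t
    simpa using ((hasDerivAt_id t).smul_const e).const_add x
  have hdu : Differentiable ℝ u := hu.differentiable (by norm_num)
  have hdu2 : Differentiable ℝ (fun y => fderiv ℝ u y e) := by
    have : ContDiff ℝ 1 (fun y => fderiv ℝ u y e) :=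
      (hu.fderiv_right (m := 1) (by norm_num)).clm_apply contDiff_const
    exact this.differentiable (by norm_num)
  have ha : ∀ t : ℝ, HasDerivAt (fun s : ℝ => x k + s * c + ω) c t := by
    intro t
    simpa using (((hasDerivAt_id t).mul_const c).const_add (x k)).add_const ω
  have hq : ∀ t : ℝ, HasDerivAt (fun s : ℝ => ε * (‖x - x₀‖ ^ 2 + 2 * (x - x₀) i * s + s ^ 2))
      (ε * (2 * (x - x₀) i + 2 * t)) t := by
    intro t
    have := ((((hasDerivAt_id t).const_mul (2 * (x - x₀) i)).const_add (‖x - x₀‖ ^ 2)).add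
      ((hasDerivAt_id t).pow 2)).const_mul ε
    simpa using this
  have hq2 : HasDerivAt (fun t : ℝ => ε * (2 * (x - x₀) i + 2 * t)) (ε * 2) 0 := by
    simpa using (((hasDerivAt_id (0:ℝ)).const_mul 2).const_add (2 * (x - x₀) i)).const_mul ε
  have hnorm : ∀ t : ℝ, ‖x + t • e - x₀‖ ^ 2 = ‖x - x₀‖ ^ 2 + 2 * (x - x₀) i * t + t ^ 2 := by
    intro t
    have h1 : x + t • e - x₀ = (x - x₀) + t • e := by abel
    have h2 : ⟪x - x₀, e⟫ = (x - x₀) i := by simp [he, EuclideanSpace.inner_single_right]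
    rw [h1, norm_add_sq_real, inner_smul_right, h2, norm_smul, mul_pow]
    simp [he]
    ring
  have key := second_deriv_nonpos
    (fun t => u (x + t • e) - H (x k + t * c + ω)
      - ε * (‖x - x₀‖ ^ 2 + 2 * (x - x₀) i * t + t ^ 2))
    (fun t => fderiv ℝ u (x + t • e) e - (1 - H (x k + t * c + ω) ^ 2) / Real.sqrt 2 * c
      - ε * (2 * (x - x₀) i + 2 * t))
    (fderiv ℝ (fun y => fderiv ℝ u y e) x e - (H (x k + ω) ^ 3 - H (x k + ω)) * c * c - ε * 2)
    ?_ ?_ ?_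
  · by_cases hki : k = i
    · simp only [hc, hki, if_true] at key ⊢
      linarith
    · simp only [hc, hki, if_false] at key ⊢
      linarith
  · intro t
    exact (((hdu _).hasFDerivAt.comp_hasDerivAt t (hline t)).sub
      ((H_hasDerivAt _).comp t (ha t))).sub (hq t)
  · have h1 := (hdu2 (x + (0:ℝ) • e)).hasFDerivAt.comp_hasDerivAt (0:ℝ) (hline 0)
    have h2 := ((H_deriv2 _).comp (0:ℝ) (ha 0)).mul_const c
    have h3 := (h1.sub h2).sub hq2
    simp only [zero_smul, add_zero, zero_mul] at h3
    exact h3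
  · refine Filter.Eventually.of_forall fun t => ?_
    have := hmax (x + t • e)
    rw [hnorm] at this
    have h4 : (x + t • e) k = x k + t * c := by simp [hec]
    rw [h4] at this
    simpa using this

theorem exists_max {n : ℕ} (u : EuclideanSpace ℝ (Fin n) → ℝ) (hu : Continuous u)
    (hrange : ∀ x, -1 < u x ∧ u x < 1)
    (k : Fin n) (ω ε : ℝ) (hε : 0 < ε) (x₀ : EuclideanSpace ℝ (Fin n)) :
    ∃ x, ∀ y, u y - H (y k + ω) - ε * ‖y - x₀‖ ^ 2 ≤ u x - H (x k + ω) - ε * ‖x - x₀‖ ^ 2 := by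
  have hH : Continuous H := continuous_iff_continuousAt.2 fun t => (H_hasDerivAt t).continuousAt
  have hcont : Continuous fun y : EuclideanSpace ℝ (Fin n) =>
      u y - H (y k + ω) - ε * ‖y - x₀‖ ^ 2 := by fun_prop
  set r : ℝ := Real.sqrt (4 / ε) with hr
  have hr2 : ε * r ^ 2 = 4 := by
    rw [hr, Real.sq_sqrt (by positivity)]; field_simp
  have hr0 : 0 ≤ r := Real.sqrt_nonneg _
  obtain ⟨x, hx, hxm⟩ := (isCompact_closedBall x₀ r).exists_isMaxOn
    ⟨x₀, Metric.mem_closedBall_self hr0⟩ hcont.continuousOn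
  refine ⟨x, fun y => ?_⟩
  by_cases hy : y ∈ Metric.closedBall x₀ r
  · exact hxm hy
  · have h0 : u x₀ - H (x₀ k + ω) - ε * ‖x₀ - x₀‖ ^ 2 ≤ u x - H (x k + ω) - ε * ‖x - x₀‖ ^ 2 :=
      hxm (Metric.mem_closedBall_self hr0)
    refine le_trans ?_ h0
    rw [Metric.mem_closedBall, dist_eq_norm, not_le] at hy
    have h1 : ε * r ^ 2 ≤ ε * ‖y - x₀‖ ^ 2 := by gcongr
    have h2 := abs_lt.1 ((sq_lt_one_iff_abs_lt_one _).1 (H_sq_lt (x₀ k + ω)))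
    have h3 := abs_lt.1 ((sq_lt_one_iff_abs_lt_one _).1 (H_sq_lt (y k + ω)))
    have h4 := hrange x₀
    have h5 := hrange y
    simp only [sub_self, norm_zero]
    linarith [h2.1, h2.2, h3.1, h3.2, h4.1, h4.2, h5.1, h5.2]

theorem sliding_upper_bound {n : ℕ} (hn1 : 1 ≤ n)
    (u : EuclideanSpace ℝ (Fin n) → ℝ) (hu : IsACSolution u)
    (hrange : ∀ x, -1 < u x ∧ u x < 1)
    (hlim : ∀ ε : ℝ, 0 < ε → ∃ R : ℝ, 0 < R ∧
      ∀ x : EuclideanSpace ℝ (Fin n), x ⟨n - 1, by omega⟩ ≤ -R → |u x + 1| ≤ ε)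
    (A : ℝ) (hA : 0 < A)
    (huA : ∀ x : EuclideanSpace ℝ (Fin n),
      x ⟨n - 1, by omega⟩ ≤ -A → u x ≤ -(1 / Real.sqrt 3))
    (htanh : 1 / Real.sqrt 3 ≤ Real.tanh (A / Real.sqrt 2)) :
    ∀ ω : ℝ, 2 * A ≤ ω → ∀ x : EuclideanSpace ℝ (Fin n),
      u x ≤ H (x ⟨n - 1, by omega⟩ + ω) := by
  intro ω hω x₀
  obtain ⟨hC, hE⟩ := hu
  set k : Fin n := ⟨n - 1, by omega⟩ with hk
  by_contra! hlt
  set δ : ℝ := u x₀ - H (x₀ k + ω) with hδ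
  have hδ0 : 0 < δ := sub_pos.2 hlt
  have hn0 : (0 : ℝ) < n := by exact_mod_cast hn1
  set ε : ℝ := δ ^ 3 / (4 * n) with hεd
  have hε : 0 < ε := by positivity
  obtain ⟨x, hx⟩ := exists_max u hC.continuous hrange k ω ε hε x₀
  have hw : δ ≤ u x - H (x k + ω) := by
    have h := hx x₀
    simp only [sub_self, norm_zero] at h
    have : 0 ≤ ε * ‖x - x₀‖ ^ 2 := by positivity
    linarith
  have hlap : laplacian u x ≤ (H (x k + ω) ^ 3 - H (x k + ω)) + n * (2 * ε) := by
    unfold laplacian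
    refine (Finset.sum_le_sum fun i _ => dir_ineq u hC k ω ε x₀ x hx i).trans ?_
    rw [Finset.sum_add_distrib]
    simp
  have hnε : n * (2 * ε) = δ ^ 3 / 2 := by
    rw [hεd]; field_simp; norm_num
  have hEx := hE x
  have hcub : (u x - H (x k + ω)) ^ 3
      ≤ (u x ^ 3 - u x) - (H (x k + ω) ^ 3 - H (x k + ω)) := by
    rcases le_total (x k) (-A) with hA1 | hA1
    · have h := cubic_pos (-u x) (-H (x k + ω)) (by linarith [huA x hA1]) (by linarith)
      have e1 : (-H (x k + ω) - -u x) ^ 3 = (u x - H (x k + ω)) ^ 3 := by ring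
      rw [e1] at h
      linarith [h, (by ring : (-H (x k + ω)) ^ 3 = - H (x k + ω) ^ 3),
        (by ring : (-u x) ^ 3 = - u x ^ 3)]
    · apply cubic_pos _ _ _ (by linarith)
      exact htanh.trans (H_mono (by linarith : A ≤ x k + ω))
  have h3 : δ ^ 3 ≤ (u x - H (x k + ω)) ^ 3 := by gcongr
  have : 0 < δ ^ 3 := by positivity
  linarith
end
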